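/- arXiv:1603.05639 — 3 statements merged into one kernel-verified Lean document; each statement's English description precedes it below -/
import Mathlib

section
/- Let G be a connected d-regular Eulerian digraph on n vertices, let A ⊆ V with A ≠ V, and let v ∈ A. Then the simple random walk on G satisfies E_v[τ_{A^c}] ≤ 10·|A|². -/
open Finset

/-- The out-degree of a vertex in a digraph. -/
def dout {V : Type} [Fintype V] (E : V → V → Prop) [DecidableRel E] (x : V) : ℕ :=
  (Finset.univ.filter fun y => E x y).card

/-- The in-degree of a vertex in a digraph. -/
def din {V : Type} [Fintype V] (E : V → V → Prop) [DecidableRel E] (x : V) : ℕ :=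
  (Finset.univ.filter fun y => E y x).card

/-- The number of directed edges of a digraph. -/
def numEdges {V : Type} [Fintype V] (E : V → V → Prop) [DecidableRel E] : ℕ :=
  ∑ x, dout E x

/-- The transition matrix of the (non-lazy) simple random walk on a digraph. -/
noncomputable def srwP {V : Type} [Fintype V] [DecidableEq V] (E : V → V → Prop)
    [DecidableRel E] : Matrix V V ℝ :=
  fun v w => if E v w then 1 / (dout E v : ℝ) else 0

/-- The probability that a Markov chain with transition matrix `P` follows the trajectory
`x 0, x 1, …, x t` (given that it starts at `x 0`). -/
noncomputable def pathWeight {V : Type} [Fintype V] (P : Matrix V V ℝ) {t : ℕ}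
    (x : Fin (t + 1) → V) : ℝ :=
  ∏ i : Fin t, P (x i.castSucc) (x i.succ)

/-- The substochastic matrix `Q` of the chain `P` killed on the set `A`:
`Q(x,y) = P(x,y)` if `x ∉ A` and `y ∉ A`, and `Q(x,y) = 0` otherwise. -/
noncomputable def hitQ {V : Type} [Fintype V] [DecidableEq V] (P : Matrix V V ℝ)
    (A : Finset V) : Matrix V V ℝ :=
  fun x y => if x ∉ A ∧ y ∉ A then P x y else 0

/-- The partial sums `∑_{t<T} ∑_{w∉A} Q^t(v,w)` of the series defining the expected hitting
time `E_v[τ_A] = ∑_{t=0}^∞ ∑_{w∉A} Q^t(v,w)`. -/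
noncomputable def hitTimePartial {V : Type} [Fintype V] [DecidableEq V] (P : Matrix V V ℝ)
    (A : Finset V) (v : V) (T : ℕ) : ℝ :=
  ∑ t ∈ Finset.range T, ∑ w ∈ Finset.univ.filter (fun w => w ∉ A), (hitQ P A ^ t) v w

/-- On a regular digraph, the sum of the squared differences of `h` over the edges is twice the
pairing of `h` with its (unnormalised) Laplacian. -/
lemma edge_energy_eq {V : Type} [Fintype V] (E : V → V → Prop) [DecidableRel E] {d : ℕ}
    (hreg : ∀ x, dout E x = d ∧ din E x = d) (h : V → ℝ) :
    ∑ x, ∑ y, (if E x y then (h x - h y) ^ 2 else 0) =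
      2 * ∑ x, h x * (d * h x - ∑ y, if E x y then h y else 0) := by
  have hout : ∑ x, ∑ y, (if E x y then h x ^ 2 else 0) = ∑ x, d * h x ^ 2 := by
    refine sum_congr rfl fun x _ => ?_
    rw [← sum_filter, sum_const, nsmul_eq_mul, ← (hreg x).1, dout]
  have hin : ∑ x, ∑ y, (if E x y then h y ^ 2 else 0) = ∑ y, d * h y ^ 2 := by
    rw [sum_comm]
    refine sum_congr rfl fun y _ => ?_
    rw [← sum_filter, sum_const, nsmul_eq_mul, ← (hreg y).2, din]
  have hsplit : ∑ x, ∑ y, (if E x y then (h x - h y) ^ 2 else 0) =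
      ∑ x, ∑ y, (if E x y then h x ^ 2 else 0) + ∑ x, ∑ y, (if E x y then h y ^ 2 else 0)
        - 2 * ∑ x, ∑ y, (if E x y then h x * h y else 0) := by
    simp only [mul_sum, ← sum_add_distrib, ← sum_sub_distrib]
    refine sum_congr rfl fun x _ => sum_congr rfl fun y _ => ?_
    split_ifs <;> ring
  have hcross : ∑ x, ∑ y, (if E x y then h x * h y else 0) =
      ∑ x, h x * ∑ y, (if E x y then h y else 0) := by
    simp only [mul_sum, mul_ite, mul_zero]
  rw [hsplit, hout, hin, hcross]
  simp only [mul_sub, sum_sub_distrib]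
  have : ∑ x, h x * (d * h x) = ∑ x, d * h x ^ 2 := sum_congr rfl fun x _ => by ring
  rw [this]
  ring

/-- In a connected regular digraph, from every vertex there is a path leaving `A`, along which the
distance from the starting point increases by one at each step, and whose length `L` satisfies
`L * d ≤ 3 * |A| + d`. -/
lemma exists_short_exit_path {V : Type} [Fintype V] [DecidableEq V] (E : V → V → Prop)
    [DecidableRel E] {d : ℕ} (hreg : ∀ x, dout E x = d ∧ din E x = d)
    (hconn : (SimpleGraph.fromRel E).Connected) {A : Finset V} (hA : A ≠ univ) (v : V) :
    ∃ (L : ℕ) (x : ℕ → V), x 0 = v ∧ x L ∉ A ∧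
      (∀ i < L, E (x i) (x (i + 1)) ∨ E (x (i + 1)) (x i)) ∧
      (∀ i ≤ L, (SimpleGraph.fromRel E).dist v (x i) = i) ∧ L * d ≤ 3 * A.card + d := by
  set G := SimpleGraph.fromRel E with hG
  have hne : (Aᶜ).Nonempty := by
    rw [nonempty_iff_ne_empty, Ne, compl_eq_empty_iff]
    exact hA
  obtain ⟨u, hu, hmin⟩ := exists_min_image Aᶜ (fun w => G.dist v w) hne
  obtain ⟨p, hp⟩ := hconn.exists_walk_length_eq_dist v u
  have hdist : ∀ i ≤ p.length, G.dist v (p.getVert i) = i := by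
    intro i hi
    have h1 : G.dist v (p.getVert i) ≤ i :=
      (SimpleGraph.dist_le (p.take i)).trans (by simp)
    have h2 : G.dist (p.getVert i) u ≤ p.length - i :=
      (SimpleGraph.dist_le (p.drop i)).trans (by simp)
    have h3 := hconn.dist_triangle (u := v) (v := p.getVert i) (w := u)
    omega
  have hclose : ∀ w z, E w z → G.dist v z ≤ G.dist v w + 1 ∧ G.dist v w ≤ G.dist v z + 1 := by
    intro w z hwz
    by_cases hwz' : w = z
    · subst hwz'; omega
    · have hadj : G.Adj w z := by
        rw [hG, SimpleGraph.fromRel_adj]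
        exact ⟨hwz', Or.inl hwz⟩
      have h1 : G.dist w z = 1 := SimpleGraph.dist_eq_one_iff_adj.2 hadj
      have h2 : G.dist z w = 1 := SimpleGraph.dist_eq_one_iff_adj.2 hadj.symm
      have h3 := hconn.dist_triangle (u := v) (v := w) (w := z)
      have h4 := hconn.dist_triangle (u := v) (v := z) (w := w)
      omega
  refine ⟨p.length, p.getVert, by simp, by simpa using hu, ?_, hdist, ?_⟩
  · intro i hi
    exact ((SimpleGraph.fromRel_adj E _ _).1 (p.adj_getVert_succ hi)).2
  · have hcount := card_mul_le_card_mul (s := range (p.length - 1)) (t := A)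
      (fun i y => E (p.getVert i) y) (m := d) (n := 3) ?_ ?_
    · rw [card_range] at hcount
      have hle : p.length ≤ (p.length - 1) + 1 := by omega
      calc p.length * d ≤ ((p.length - 1) + 1) * d := Nat.mul_le_mul_right d hle
        _ = (p.length - 1) * d + d := by ring
        _ ≤ 3 * A.card + d := by omega
    · intro i hi
      rw [mem_range] at hi
      rw [← (hreg (p.getVert i)).1, dout]
      refine card_le_card fun y hy => ?_
      simp only [mem_filter, mem_univ, true_and] at hy
      simp only [bipartiteAbove, mem_filter]
      refine ⟨?_, hy⟩
      by_contra hyA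
      have h1 := hmin y (mem_compl.2 hyA)
      have h2 := (hclose _ _ hy).1
      have h3 := hdist i (by omega)
      omega
    · intro y _
      have hsub : (range (p.length - 1)).bipartiteBelow (fun i y => E (p.getVert i) y) y ⊆
          Icc (G.dist v y - 1) (G.dist v y + 1) := by
        intro i hi
        simp only [bipartiteBelow, mem_filter, mem_range] at hi
        have h1 := hclose _ _ hi.2
        rw [hdist i (by omega)] at h1
        rw [mem_Icc]
        omega
      refine (card_le_card hsub).trans ?_
      rw [Nat.card_Icc]
      omega

/-- The energy of `h` over the edges of a digraph bounds the squared differences of `h` along a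
path whose distance from its starting point increases by one at each step. -/
lemma sum_sq_path_le_edge_energy {V : Type} [Fintype V] [DecidableEq V] (E : V → V → Prop)
    [DecidableRel E] (h δ : V → ℝ) {L : ℕ} {x : ℕ → V}
    (hx : ∀ i < L, E (x i) (x (i + 1)) ∨ E (x (i + 1)) (x i)) (hδ : ∀ i ≤ L, δ (x i) = i) :
    ∑ i ∈ range L, (h (x i) - h (x (i + 1))) ^ 2 ≤
      ∑ x, ∑ y, (if E x y then (h x - h y) ^ 2 else 0) := by
  set f : ℕ → V × V := fun i =>
    if E (x i) (x (i + 1)) then (x i, x (i + 1)) else (x (i + 1), x i) with hf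
  set g : V × V → ℝ := fun p => if E p.1 p.2 then (h p.1 - h p.2) ^ 2 else 0 with hg
  have hfδ : ∀ i < L, δ (f i).1 + δ (f i).2 = 2 * i + 1 := by
    intro i hi
    have h1 := hδ i hi.le
    have h2 := hδ (i + 1) hi
    push_cast at h2
    simp only [hf]
    split_ifs <;> simp only [h1, h2] <;> ring
  have hinj : Set.InjOn f (range L) := by
    intro i hi j hj hij
    have h1 := hfδ i (by simpa using hi)
    rw [hij, hfδ j (by simpa using hj)] at h1
    have : (j : ℝ) = i := by linarith
    exact_mod_cast this.symm
  calc ∑ i ∈ range L, (h (x i) - h (x (i + 1))) ^ 2 = ∑ i ∈ range L, g (f i) := by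
        refine sum_congr rfl fun i hi => ?_
        have hE := hx i (mem_range.1 hi)
        by_cases h1 : E (x i) (x (i + 1))
        · simp [hf, hg, h1]
        · have h2 := hE.resolve_left h1
          simp only [hf, hg, h1, h2, if_true, if_false]
          ring
    _ = ∑ p ∈ (range L).image f, g p := (sum_image hinj).symm
    _ ≤ ∑ p, g p := by
        refine sum_le_sum_of_subset_of_nonneg (subset_univ _) fun p _ _ => ?_
        simp only [hg]
        split_ifs <;> positivity
    _ = _ := Fintype.sum_prod_type g

/-- A nonnegative function supported on `A` whose Laplacian is at most `1` on `A` is bounded by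
`10 * |A| ^ 2`. -/
lemma le_of_laplacian_le_one {V : Type} [Fintype V] [DecidableEq V] (E : V → V → Prop)
    [DecidableRel E] {d : ℕ} (hreg : ∀ x, dout E x = d ∧ din E x = d)
    (hconn : (SimpleGraph.fromRel E).Connected) {A : Finset V} (hA : A ≠ univ) {h : V → ℝ}
    (h0 : ∀ x, 0 ≤ h x) (hsupp : ∀ x ∉ A, h x = 0)
    (hlap : ∀ x ∈ A, d * h x ≤ d + ∑ y, if E x y then h y else 0) {v : V} (hv : v ∈ A) :
    h v ≤ 10 * (A.card : ℝ) ^ 2 := by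
  obtain ⟨m, hm, hmax⟩ := exists_max_image A h ⟨v, hv⟩
  refine (hmax v hv).trans ?_
  have hmax' : ∀ y, h y ≤ h m := fun y => by
    by_cases hy : y ∈ A
    · exact hmax y hy
    · rw [hsupp y hy]; exact h0 m
  have ha : (1 : ℝ) ≤ A.card := by exact_mod_cast card_pos.2 ⟨v, hv⟩
  obtain ⟨L, x, hx0, hxL, hxE, hxd, hL⟩ := exists_short_exit_path E hreg hconn hA m
  have hLpos : 0 < L := by
    rcases Nat.eq_zero_or_pos L with rfl | hpos
    · exact absurd hm (hx0 ▸ hxL)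
    · exact hpos
  have hd : 0 < d := by
    rcases hxE 0 hLpos with hE | hE <;>
    · rw [← (hreg _).1, dout, card_pos]
      exact ⟨_, mem_filter.2 ⟨mem_univ _, hE⟩⟩
  have hdR : (0 : ℝ) < d := by exact_mod_cast hd
  rcases le_total (2 * (A.card : ℝ)) d with hbig | hsmall
  · have hsum : ∑ y, (if E m y then h y else 0) ≤ A.card * h m := by
      calc ∑ y, (if E m y then h y else 0) ≤ ∑ y, h y :=
            sum_le_sum fun y _ => by split_ifs; exacts [le_rfl, h0 y]
        _ = ∑ y ∈ A, h y := (sum_subset (subset_univ A) fun y _ hy => hsupp y hy).symm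
        _ ≤ A.card * h m := by
            rw [← nsmul_eq_mul]; exact sum_le_card_nsmul A h _ hmax
    have h1 := hlap m hm
    have h2 : A.card * h m ≤ d / 2 * h m :=
      mul_le_mul_of_nonneg_right (by linarith) (h0 m)
    have h3 : d * h m ≤ d * 2 := by linarith
    have h4 := le_of_mul_le_mul_left h3 hdR
    nlinarith
  · have henergy : ∑ x, ∑ y, (if E x y then (h x - h y) ^ 2 else 0) ≤
        2 * (A.card * (h m * d)) := by
      rw [edge_energy_eq E hreg h]
      refine mul_le_mul_of_nonneg_left ?_ zero_le_two
      rw [← sum_subset (subset_univ A) fun y _ hy => by rw [hsupp y hy, zero_mul],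
        ← nsmul_eq_mul]
      refine sum_le_card_nsmul A _ _ fun y hy => ?_
      calc _ ≤ h y * d := mul_le_mul_of_nonneg_left (by linarith [hlap y hy]) (h0 y)
        _ ≤ h m * d := mul_le_mul_of_nonneg_right (hmax' y) hdR.le
    have hpath := sum_sq_path_le_edge_energy E h
      (fun y => ((SimpleGraph.fromRel E).dist m y : ℝ)) hxE fun i hi => by
        exact_mod_cast hxd i hi
    have htel : ∑ i ∈ range L, (h (x i) - h (x (i + 1))) = h m := by
      rw [sum_range_sub' (fun i => h (x i)), hx0, hsupp _ hxL, sub_zero]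
    have hcs := sq_sum_le_card_mul_sum_sq (s := range L)
      (f := fun i => h (x i) - h (x (i + 1)))
    rw [htel, card_range] at hcs
    have hsq : h m ^ 2 ≤ L * (2 * (A.card * (h m * d))) :=
      hcs.trans (mul_le_mul_of_nonneg_left (hpath.trans henergy) (Nat.cast_nonneg L))
    have hLR : (L : ℝ) * d ≤ 3 * A.card + d := by exact_mod_cast hL
    rcases (h0 m).eq_or_lt with hz | hpos
    · rw [← hz]; positivity
    · have h1 : h m * h m ≤ (2 * A.card * (L * d)) * h m := by linarith
      have h2 := le_of_mul_le_mul_right h1 hpos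
      have h3 : 2 * A.card * (L * d) ≤ 2 * A.card * (5 * A.card : ℝ) :=
        mul_le_mul_of_nonneg_left (by linarith) (by positivity)
      linarith

lemma hitQ_nonneg {V : Type} [Fintype V] [DecidableEq V] {P : Matrix V V ℝ}
    (hP : ∀ x y, 0 ≤ P x y) (B : Finset V) (x y : V) : 0 ≤ hitQ P B x y := by
  unfold hitQ
  split_ifs
  exacts [hP x y, le_rfl]

lemma hitQ_pow_nonneg {V : Type} [Fintype V] [DecidableEq V] {P : Matrix V V ℝ}
    (hP : ∀ x y, 0 ≤ P x y) (B : Finset V) (t : ℕ) (x y : V) : 0 ≤ (hitQ P B ^ t) x y := by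
  induction t generalizing x with
  | zero =>
    rw [pow_zero, Matrix.one_apply]
    split_ifs <;> norm_num
  | succ t ih =>
    rw [pow_succ', Matrix.mul_apply]
    exact sum_nonneg fun z _ => mul_nonneg (hitQ_nonneg hP B x z) (ih z)

lemma hitTimePartial_nonneg {V : Type} [Fintype V] [DecidableEq V] {P : Matrix V V ℝ}
    (hP : ∀ x y, 0 ≤ P x y) (B : Finset V) (x : V) (T : ℕ) : 0 ≤ hitTimePartial P B x T :=
  sum_nonneg fun t _ => sum_nonneg fun w _ => hitQ_pow_nonneg hP B t x w

lemma hitTimePartial_le_succ {V : Type} [Fintype V] [DecidableEq V] {P : Matrix V V ℝ}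
    (hP : ∀ x y, 0 ≤ P x y) (B : Finset V) (x : V) (T : ℕ) :
    hitTimePartial P B x T ≤ hitTimePartial P B x (T + 1) := by
  rw [hitTimePartial, hitTimePartial, sum_range_succ]
  exact le_add_of_nonneg_right (sum_nonneg fun w _ => hitQ_pow_nonneg hP B T x w)

/-- First-step decomposition of the partial sums of the expected hitting time. -/
lemma hitTimePartial_succ {V : Type} [Fintype V] [DecidableEq V] (P : Matrix V V ℝ)
    (B : Finset V) (x : V) (T : ℕ) :
    hitTimePartial P B x (T + 1) =
      (if x ∉ B then 1 else 0) + ∑ y, hitQ P B x y * hitTimePartial P B y T := by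
  rw [hitTimePartial, sum_range_succ', add_comm]
  congr 1
  · simp [Matrix.one_apply]
  · simp only [hitTimePartial, pow_succ', Matrix.mul_apply, mul_sum]
    rw [sum_comm]
    conv_rhs => rw [sum_comm]
    rw [sum_comm]
    refine sum_congr rfl fun t _ => ?_
    rw [sum_comm]

lemma hitTimePartial_of_mem {V : Type} [Fintype V] [DecidableEq V] (P : Matrix V V ℝ)
    {B : Finset V} {x : V} (hx : x ∈ B) (T : ℕ) : hitTimePartial P B x T = 0 := by
  cases T with
  | zero => simp [hitTimePartial]
  | succ T => simp [hitTimePartial_succ, hitQ, hx]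

/-- Let `G` be a connected `d`-regular Eulerian digraph, `A ⊊ V` and
`v ∈ A`. Then the simple random walk satisfies `E_v[τ_{Aᶜ}] ≤ 10·|A|²` (the expected hitting
time `E_v[τ_{Aᶜ}] = ∑_{t=0}^∞ ∑_{w∈A} Q^t(v,w)` being bounded through its partial sums). -/
theorem regular_eulerian_exit_time
    (V : Type) [Fintype V] [DecidableEq V] (E : V → V → Prop) [DecidableRel E] (d : ℕ)
    (hloop : ∀ x, ¬ E x x)
    (hreg : ∀ x, dout E x = d ∧ din E x = d)
    (hconn : (SimpleGraph.fromRel E).Connected)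
    (A : Finset V) (hA : A ≠ Finset.univ) (v : V) (hv : v ∈ A) :
    ∀ T : ℕ, hitTimePartial (srwP E) Aᶜ v T ≤ 10 * (A.card : ℝ) ^ 2 := by
  intro T
  have hP : ∀ x y, 0 ≤ srwP E x y := fun x y => by
    unfold srwP
    split_ifs <;> positivity
  refine le_of_laplacian_le_one E hreg hconn hA
    (h := fun x => hitTimePartial (srwP E) Aᶜ x T)
    (fun x => hitTimePartial_nonneg hP _ x T)
    (fun x hx => hitTimePartial_of_mem _ (mem_compl.2 hx) T) (fun x hx => ?_) hv
  have hstep := (hitTimePartial_le_succ hP Aᶜ x T).trans_eq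
    (hitTimePartial_succ (srwP E) Aᶜ x T)
  rw [if_pos (by simpa using hx)] at hstep
  refine (mul_le_mul_of_nonneg_left hstep (Nat.cast_nonneg d)).trans ?_
  rw [mul_add, mul_one, mul_sum]
  refine add_le_add_right (sum_le_sum fun y _ => ?_) _
  by_cases hy : y ∈ A
  · by_cases hE : E x y
    · simp only [hitQ, srwP, hx, hy, hE, (hreg x).1, mem_compl, not_true_eq_false,
        not_false_eq_true, and_self, if_true]
      rw [← mul_assoc]
      refine mul_le_of_le_one_left (hitTimePartial_nonneg hP _ y T) ?_
      rw [mul_one_div]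
      exact div_self_le_one _
    · simp [hitQ, srwP, hE]
  · simp [hitTimePartial_of_mem (srwP E) (mem_compl.2 hy) T]
end

section
/- Let G be a connected d-regular Eulerian digraph on n vertices with transition matrix P of the simple random walk. Then for every vertex v and every integer t with 1 ≤ t ≤ 10·n², the expected number of visits to v before time t starting from v satisfies ∑_{s=0}^{t−1} P^s(v,v) ≤ 8·√t. -/
open Finset

section Preliminaries

variable {V : Type} [Fintype V] {E : V → V → Prop} [DecidableRel E]

/-- The sum of squared increments of a function along the directed edges of a digraph. -/
noncomputable def edgeEnergy (E : V → V → Prop) [DecidableRel E] (g : V → ℝ) : ℝ :=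
  ∑ x, ∑ y, if E x y then (g x - g y) ^ 2 else 0

lemma sum_edge_ite_eq_dout_mul (x : V) (c : ℝ) :
    ∑ y, (if E x y then c else 0) = dout E x * c := by
  rw [← Finset.sum_filter, Finset.sum_const, nsmul_eq_mul, dout]

lemma sum_edge_ite_eq_din_mul (y : V) (c : ℝ) :
    ∑ x, (if E x y then c else 0) = din E y * c := by
  rw [← Finset.sum_filter, Finset.sum_const, nsmul_eq_mul, din]

lemma sum_le_edgeEnergy (s : Finset (V × V)) (hs : ∀ e ∈ s, E e.1 e.2) (g : V → ℝ) :
    ∑ e ∈ s, (g e.1 - g e.2) ^ 2 ≤ edgeEnergy E g := by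
  rw [edgeEnergy, ← Fintype.sum_prod_type' (f := fun x y => if E x y then (g x - g y) ^ 2 else 0)]
  calc ∑ e ∈ s, (g e.1 - g e.2) ^ 2
      = ∑ e ∈ s, (if E e.1 e.2 then (g e.1 - g e.2) ^ 2 else 0) :=
        Finset.sum_congr rfl fun e he => by rw [if_pos (hs e he)]
    _ ≤ _ := Finset.sum_le_sum_of_subset_of_nonneg (Finset.subset_univ s)
        fun e _ _ => by split_ifs <;> positivity

variable [DecidableEq V]

lemma srwP_nonneg (x y : V) : 0 ≤ srwP E x y := by
  unfold srwP
  split_ifs <;> positivity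

lemma srwP_pow_nonneg (s : ℕ) (x y : V) : 0 ≤ (srwP E ^ s) x y := by
  induction s generalizing y with
  | zero => rw [pow_zero, Matrix.one_apply]; split_ifs <;> norm_num
  | succ s ih =>
    rw [pow_succ, Matrix.mul_apply]
    exact Finset.sum_nonneg fun z _ => mul_nonneg (ih z) (srwP_nonneg z y)

/-- The expected number of visits to `v` before time `t`, as a function of the starting vertex. -/
noncomputable def expectedVisits (E : V → V → Prop) [DecidableRel E] (v : V) (t : ℕ) (x : V) : ℝ :=
  ∑ s ∈ Finset.range t, (srwP E ^ s) x v

lemma expectedVisits_nonneg (v : V) (t : ℕ) (x : V) : 0 ≤ expectedVisits E v t x :=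
  Finset.sum_nonneg fun s _ => srwP_pow_nonneg s x v

lemma expectedVisits_sub_srwP_mulVec (v : V) (t : ℕ) (x : V) :
    expectedVisits E v t x - ∑ y, srwP E x y * expectedVisits E v t y =
      (if x = v then 1 else 0) - (srwP E ^ t) x v := by
  have h : ∑ y, srwP E x y * expectedVisits E v t y =
      ∑ s ∈ Finset.range t, (srwP E ^ (s + 1)) x v := by
    simp only [expectedVisits, Finset.mul_sum]
    rw [Finset.sum_comm]
    refine Finset.sum_congr rfl fun s _ => ?_
    rw [pow_succ', Matrix.mul_apply]
  rw [h, expectedVisits, ← Finset.sum_sub_distrib,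
    Finset.sum_range_sub' (fun s => (srwP E ^ s) x v), pow_zero, Matrix.one_apply]

variable {d : ℕ}

lemma sum_srwP_col (hd : 0 < d) (hreg : ∀ x, dout E x = d ∧ din E x = d) (y : V) :
    ∑ x, srwP E x y = 1 := by
  simp only [srwP, (hreg _).1]
  rw [sum_edge_ite_eq_din_mul, (hreg y).2]
  field_simp

lemma sum_srwP_pow_col (hd : 0 < d) (hreg : ∀ x, dout E x = d ∧ din E x = d) (s : ℕ) (y : V) :
    ∑ x, (srwP E ^ s) x y = 1 := by
  induction s with
  | zero => simp [Matrix.one_apply]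
  | succ s ih =>
    simp only [pow_succ', Matrix.mul_apply]
    rw [Finset.sum_comm]
    simp only [← Finset.sum_mul, sum_srwP_col hd hreg, one_mul, ih]

lemma sum_expectedVisits (hd : 0 < d) (hreg : ∀ x, dout E x = d ∧ din E x = d) (v : V) (t : ℕ) :
    ∑ x, expectedVisits E v t x = t := by
  simp only [expectedVisits]
  rw [Finset.sum_comm]
  simp [sum_srwP_pow_col hd hreg]

/-- In a regular Eulerian digraph the Dirichlet form of the walk is a sum over directed edges. -/
lemma edgeEnergy_eq_dirichlet (hd : 0 < d) (hreg : ∀ x, dout E x = d ∧ din E x = d)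
    (g : V → ℝ) :
    edgeEnergy E g = 2 * d * ∑ x, g x * (g x - ∑ y, srwP E x y * g y) := by
  have hd' : (d : ℝ) ≠ 0 := by positivity
  have hsplit : ∀ x y, (if E x y then (g x - g y) ^ 2 else 0) =
      (if E x y then g x ^ 2 else 0) + (if E x y then g y ^ 2 else 0)
        - 2 * d * (g x * (srwP E x y * g y)) := by
    intro x y
    simp only [srwP, (hreg x).1]
    split_ifs
    · field_simp
      ring
    · ring
  have hout : ∑ x, ∑ y, (if E x y then g x ^ 2 else 0) = d * ∑ x, g x ^ 2 := by
    simp only [sum_edge_ite_eq_dout_mul, (hreg _).1, Finset.mul_sum]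
  have hin : ∑ x, ∑ y, (if E x y then g y ^ 2 else 0) = d * ∑ x, g x ^ 2 := by
    rw [Finset.sum_comm]
    simp only [sum_edge_ite_eq_din_mul, (hreg _).2, Finset.mul_sum]
  simp only [edgeEnergy, hsplit, Finset.sum_sub_distrib, Finset.sum_add_distrib, hout, hin,
    mul_sub, ← Finset.mul_sum]
  simp only [← sq]
  ring

lemma edgeEnergy_expectedVisits_le (hd : 0 < d) (hreg : ∀ x, dout E x = d ∧ din E x = d)
    (v : V) (t : ℕ) :
    edgeEnergy E (expectedVisits E v t) ≤ 2 * d * expectedVisits E v t v := by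
  rw [edgeEnergy_eq_dirichlet hd hreg]
  simp only [expectedVisits_sub_srwP_mulVec]
  refine mul_le_mul_of_nonneg_left ?_ (by positivity)
  calc ∑ x, expectedVisits E v t x * ((if x = v then 1 else 0) - (srwP E ^ t) x v)
      ≤ ∑ x, expectedVisits E v t x * (if x = v then 1 else 0) :=
        Finset.sum_le_sum fun x _ => mul_le_mul_of_nonneg_left
          (sub_le_self _ (srwP_pow_nonneg t x v)) (expectedVisits_nonneg v t x)
    _ = _ := by simp

/-- If `g` drops by at least `c` from `v` to every vertex outside `A`, then each of the at least
`d - |A|` edges from `v` out of `A` contributes at least `c ^ 2` to the energy. -/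
lemma sub_card_mul_sq_le_edgeEnergy (hreg : ∀ x, dout E x = d ∧ din E x = d) (g : V → ℝ) (v : V)
    (A : Finset V) {c : ℝ} (hc : 0 ≤ c) (hA : ∀ x, x ∉ A → c ≤ g v - g x) :
    ((d : ℝ) - A.card) * c ^ 2 ≤ edgeEnergy E g := by
  set N : Finset V := Finset.univ.filter fun y => E v y with hN
  have hNcard : N.card = d := (hreg v).1
  have hcard : (d : ℝ) - A.card ≤ (N \ A).card := by
    have := Finset.le_card_sdiff A N
    rw [sub_le_iff_le_add]
    exact_mod_cast (by omega : d ≤ (N \ A).card + A.card)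
  calc ((d : ℝ) - A.card) * c ^ 2 ≤ (N \ A).card * c ^ 2 :=
        mul_le_mul_of_nonneg_right hcard (sq_nonneg c)
    _ = ∑ _y ∈ N \ A, c ^ 2 := by rw [Finset.sum_const, nsmul_eq_mul]
    _ ≤ ∑ y ∈ N \ A, (g v - g y) ^ 2 := Finset.sum_le_sum fun y hy =>
        pow_le_pow_left₀ hc (hA y (Finset.mem_sdiff.1 hy).2) 2
    _ = ∑ e ∈ (N \ A).image (Prod.mk v), (g e.1 - g e.2) ^ 2 := by
        rw [Finset.sum_image fun _ _ _ _ h => (Prod.mk.inj h).2]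
    _ ≤ edgeEnergy E g := sum_le_edgeEnergy _ (by
        intro e he
        obtain ⟨y, hy, rfl⟩ := Finset.mem_image.1 he
        simpa [hN] using (Finset.mem_sdiff.1 hy).1) g

end Preliminaries

section Geodesics

variable {V : Type} {G : SimpleGraph V}

lemma dist_getVert_of_length_eq_dist (hG : G.Connected) {v u : V} (p : G.Walk v u)
    (hp : p.length = G.dist v u) {i : ℕ} (hi : i ≤ p.length) : G.dist v (p.getVert i) = i := by
  have h₁ := SimpleGraph.dist_le (p.take i)
  have h₂ := SimpleGraph.dist_le (p.drop i)
  have h₃ := hG.dist_triangle (u := v) (v := p.getVert i) (w := u)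
  rw [SimpleGraph.Walk.take_length] at h₁
  rw [SimpleGraph.Walk.drop_length] at h₂
  omega

variable [Fintype V] {E : V → V → Prop} [DecidableRel E]

/-- The energy of `g` controls its increment along a geodesic of the underlying graph. -/
lemma sq_sub_le_length_mul_edgeEnergy [DecidableEq V]
    (hG : (SimpleGraph.fromRel E).Connected) {v u : V}
    (p : (SimpleGraph.fromRel E).Walk v u) (hp : p.length = (SimpleGraph.fromRel E).dist v u)
    (g : V → ℝ) : (g v - g u) ^ 2 ≤ p.length * edgeEnergy E g := by
  set x := p.getVert with hx
  have hdist : ∀ i ≤ p.length, (SimpleGraph.fromRel E).dist v (x i) = i :=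
    fun i hi => dist_getVert_of_length_eq_dist hG p hp hi
  let e : ℕ → V × V := fun i => if E (x i) (x (i + 1)) then (x i, x (i + 1)) else (x (i + 1), x i)
  have hinj : Set.InjOn e (Finset.range p.length) := by
    intro i hi j hj hij
    have hi' : i < p.length := by simpa using hi
    have hj' : j < p.length := by simpa using hj
    have hsum := congrArg (fun q : V × V => (SimpleGraph.fromRel E).dist v q.1 +
      (SimpleGraph.fromRel E).dist v q.2) hij
    have hval : ∀ k < p.length, (SimpleGraph.fromRel E).dist v (e k).1 +
        (SimpleGraph.fromRel E).dist v (e k).2 = 2 * k + 1 := by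
      intro k hk
      have h₀ := hdist k hk.le
      have h₁ := hdist (k + 1) hk
      simp only [e]
      split_ifs <;> simp only [h₀, h₁] <;> omega
    simp only [hval i hi', hval j hj'] at hsum
    omega
  have hedge : ∀ q ∈ (Finset.range p.length).image e, E q.1 q.2 := by
    intro q hq
    obtain ⟨i, hi, rfl⟩ := Finset.mem_image.1 hq
    have hadj := p.adj_getVert_succ (Finset.mem_range.1 hi)
    rw [SimpleGraph.fromRel_adj] at hadj
    simp only [e]
    split_ifs with h
    · exact h
    · exact hadj.2.resolve_left h
  have htel : ∑ i ∈ Finset.range p.length, (g (x i) - g (x (i + 1))) = g v - g u := by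
    rw [Finset.sum_range_sub' (fun i => g (x i))]
    simp [hx]
  rw [← htel]
  refine sq_sum_le_card_mul_sum_sq.trans ?_
  rw [Finset.card_range]
  refine mul_le_mul_of_nonneg_left ?_ (by positivity)
  calc ∑ i ∈ Finset.range p.length, (g (x i) - g (x (i + 1))) ^ 2
      = ∑ q ∈ (Finset.range p.length).image e, (g q.1 - g q.2) ^ 2 := by
        rw [Finset.sum_image hinj]
        refine Finset.sum_congr rfl fun i _ => ?_
        simp only [e]
        split_ifs <;> ring
    _ ≤ edgeEnergy E g := sum_le_edgeEnergy _ hedge g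

/-- A set containing all vertices closer to `v` than `u` has size at least about a third of
`d` times the distance from `v` to `u`. -/
lemma mul_dist_le_three_mul_card_add {d : ℕ} (hloop : ∀ x, ¬ E x x) (hdeg : ∀ x, dout E x = d)
    (hG : (SimpleGraph.fromRel E).Connected) {v u : V} (A : Finset V)
    (hA : ∀ y, (SimpleGraph.fromRel E).dist v y < (SimpleGraph.fromRel E).dist v u → y ∈ A) :
    d * (SimpleGraph.fromRel E).dist v u ≤ 3 * A.card + d := by
  obtain ⟨p, hp⟩ := hG.exists_walk_length_eq_dist v u
  set x := p.getVert with hx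
  set L := (SimpleGraph.fromRel E).dist v u with hL
  have hdist : ∀ i ≤ L, (SimpleGraph.fromRel E).dist v (x i) = i :=
    fun i hi => dist_getVert_of_length_eq_dist hG p hp (hp ▸ hi)
  have hnear : ∀ i ≤ L, ∀ y, E (x i) y →
      (SimpleGraph.fromRel E).dist v y ≤ i + 1 ∧ i ≤ (SimpleGraph.fromRel E).dist v y + 1 := by
    intro i hi y hy
    have hadj : (SimpleGraph.fromRel E).Adj (x i) y :=
      (SimpleGraph.fromRel_adj E _ _).2 ⟨fun h => hloop y (h ▸ hy), Or.inl hy⟩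
    have := hadj.diff_dist_adj (u := v)
    have := hdist i hi
    omega
  have hcount := Finset.sum_card_bipartiteAbove_eq_sum_card_bipartiteBelow
    (fun i y => E (x i) y) (s := Finset.range (L - 1)) (t := A)
  have habove : ∀ i ∈ Finset.range (L - 1),
      (Finset.bipartiteAbove (fun i y => E (x i) y) A i).card = d := by
    intro i hi
    rw [Finset.mem_range] at hi
    rw [← hdeg (x i), dout]
    congr 1
    ext y
    simp only [Finset.mem_bipartiteAbove, Finset.mem_filter, Finset.mem_univ, true_and,
      and_iff_right_iff_imp]
    intro hy
    have := hnear i (by omega) y hy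
    exact hA y (by omega)
  have hbelow : ∀ y ∈ A,
      (Finset.bipartiteBelow (fun i y => E (x i) y) (Finset.range (L - 1)) y).card ≤ 3 := by
    intro y _
    set k := (SimpleGraph.fromRel E).dist v y with hk
    refine (Finset.card_le_card (t := Finset.Icc (k - 1) (k + 1)) ?_).trans ?_
    · intro i hi
      rw [Finset.mem_bipartiteBelow, Finset.mem_range] at hi
      have := hnear i (by omega) y hi.2
      rw [Finset.mem_Icc]
      omega
    · rw [Nat.card_Icc]
      omega
  rw [Finset.sum_congr rfl habove, Finset.sum_const, Finset.card_range, smul_eq_mul] at hcount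
  have hle := Finset.sum_le_card_nsmul A _ 3 hbelow
  rw [← hcount, smul_eq_mul] at hle
  calc d * L ≤ d * (L - 1 + 1) := Nat.mul_le_mul_left d (by omega)
    _ = (L - 1) * d + d := by ring
    _ ≤ 3 * A.card + d := by omega

end Geodesics

/-- Let `G` be a connected `d`-regular Eulerian digraph on `n` vertices with
transition matrix `P` of the simple random walk. Then for every vertex `v` and every integer
`1 ≤ t ≤ 10·n²`, the expected number of visits to `v` before time `t` starting from `v`
satisfies `∑_{s=0}^{t−1} P^s(v,v) ≤ 8·√t`. -/
theorem regular_eulerian_return_visits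
    (V : Type) [Fintype V] [DecidableEq V] (E : V → V → Prop) [DecidableRel E] (d : ℕ)
    (hloop : ∀ x, ¬ E x x)
    (hreg : ∀ x, dout E x = d ∧ din E x = d)
    (hconn : (SimpleGraph.fromRel E).Connected)
    (v : V) (t : ℕ) (ht1 : 1 ≤ t) (ht2 : t ≤ 10 * Fintype.card V ^ 2) :
    ∑ s ∈ Finset.range t, (srwP E ^ s) v v ≤ 8 * Real.sqrt (t : ℝ) := by
  rcases Nat.eq_zero_or_pos d with rfl | hd
  · have hP : srwP E = 0 := by
      ext x y
      simp [srwP, (hreg x).1]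
    have hsum : ∑ s ∈ Finset.range t, (srwP E ^ s) v v = 1 := by
      rw [Finset.sum_eq_single_of_mem 0 (Finset.mem_range.2 ht1)
        fun s _ hs => by rw [hP, zero_pow hs, Matrix.zero_apply], pow_zero, Matrix.one_apply_eq]
    have : 1 ≤ Real.sqrt (t : ℝ) := Real.one_le_sqrt.2 (by exact_mod_cast ht1)
    linarith
  change expectedVisits E v t v ≤ _
  by_contra! hlt
  set g := expectedVisits E v t with hg
  set M := g v with hM
  have hgnn : ∀ x, 0 ≤ g x := expectedVisits_nonneg v t
  have htotal : ∑ x, g x = t := sum_expectedVisits hd hreg v t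
  have henergy : edgeEnergy E g ≤ 2 * d * M := edgeEnergy_expectedVisits_le hd hreg v t
  have ht : (1 : ℝ) ≤ t := by exact_mod_cast ht1
  have hMpos : 0 < M := lt_of_le_of_lt (by positivity) hlt
  have hMsq : 64 * (t : ℝ) < M ^ 2 := by
    have h := pow_lt_pow_left₀ hlt (by positivity) two_ne_zero
    rw [mul_pow, Real.sq_sqrt (by positivity)] at h
    linarith
  have hMt : M ≤ t := htotal ▸ Finset.single_le_sum (fun x _ => hgnn x) (Finset.mem_univ v)
  have hM64 : 64 < M := by nlinarith
  set A : Finset V := Finset.univ.filter fun x => 2 / 5 * M < g x with hA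
  have hmem : ∀ x, x ∈ A ↔ 2 / 5 * M < g x := fun x => by simp [hA]
  have hAcard : (A.card : ℝ) * (2 / 5 * M) ≤ t := by
    rw [← nsmul_eq_mul, ← htotal]
    exact (Finset.card_nsmul_le_sum A g _ fun x hx => ((hmem x).1 hx).le).trans
      (Finset.sum_le_sum_of_subset_of_nonneg (Finset.subset_univ A) fun x _ _ => hgnn x)
  have hcompl : Aᶜ.Nonempty := by
    rw [Finset.nonempty_iff_ne_empty, Ne, Finset.compl_eq_empty_iff]
    intro hAuniv
    rw [hAuniv, Finset.card_univ] at hAcard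
    have ht2' : (t : ℝ) ≤ 10 * (Fintype.card V : ℝ) ^ 2 := by exact_mod_cast ht2
    have hsq := pow_le_pow_left₀ (by positivity) hAcard 2
    nlinarith
  obtain ⟨u, huA, humin⟩ := Finset.exists_min_image Aᶜ ((SimpleGraph.fromRel E).dist v) hcompl
  have hgu : g u ≤ 2 / 5 * M := by
    rw [Finset.mem_compl, hmem] at huA
    exact not_lt.1 huA
  obtain ⟨p, hp⟩ := hconn.exists_walk_length_eq_dist v u
  have hpath := sq_sub_le_length_mul_edgeEnergy hconn p hp g
  have hball := mul_dist_le_three_mul_card_add hloop (fun x => (hreg x).1) hconn A (v := v) (u := u)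
    fun y hy => by
      by_contra hyA
      exact absurd (humin y (Finset.mem_compl.2 hyA)) (not_le.2 hy)
  rw [← hp] at hball
  have hball' : (d : ℝ) * p.length ≤ 3 * A.card + d := by exact_mod_cast hball
  have hstar := sub_card_mul_sq_le_edgeEnergy hreg g v A (c := 3 / 5 * M) (by positivity)
    fun x hx => by
      rw [hmem, not_lt] at hx
      linarith
  have hd' : (1 : ℝ) ≤ d := by exact_mod_cast hd
  have hdA : 3 * (d : ℝ) < 4 * A.card := by
    have h : ((d : ℝ) - A.card) * (9 / 25 * M) ≤ 2 * d := by
      refine le_of_mul_le_mul_right ?_ hMpos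
      nlinarith
    nlinarith
  have hdrop : (3 / 5 * M) ^ 2 ≤ p.length * (2 * d * M) :=
    (pow_le_pow_left₀ (by positivity) (by linarith : 3 / 5 * M ≤ g v - g u) 2).trans
      (hpath.trans (mul_le_mul_of_nonneg_left henergy (by positivity)))
  have hML : 9 / 25 * M ≤ 2 * (d * p.length) := by
    refine le_of_mul_le_mul_right ?_ hMpos
    linarith
  nlinarith
end

section
/- Let n ≥ 1 and let Y ⊆ ℤ/nℤ with |Y| ≤ n/2. Call a vertex v ∈ ℤ/nℤ good if v ∉ Y and for every 1 ≤ ℓ ≤ n the set {v, v+1, …, v+ℓ−1} (addition mod n) satisfies |{v, v+1, …, v+ℓ−1} ∩ Y| ≤ ℓ/2. Let B be the set of vertices that are neither in Y nor good. Then |B| ≤ |Y|. -/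
open Finset

/-- `v` is a good vertex for `Y ⊆ ℤ/nℤ` if `v ∉ Y` and, for every `1 ≤ ℓ ≤ n`, the `ℓ`
consecutive vertices `{v, v+1, …, v+ℓ−1}` (mod `n`) contain at most `ℓ/2` elements of `Y`. -/
def IsGoodVertex (n : ℕ) (Y : Finset (ZMod n)) (v : ZMod n) : Prop :=
  v ∉ Y ∧ ∀ ℓ : ℕ, 1 ≤ ℓ → ℓ ≤ n →
    2 * (((Finset.range ℓ).image fun a : ℕ => v + (a : ZMod n)) ∩ Y).card ≤ ℓ

/-- The number of elements of `Y` minus the number of non-elements among the terms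
`v, v + 1, …, v + ℓ - 1`. -/
def excess (n : ℕ) (Y : Finset (ZMod n)) (v : ZMod n) (ℓ : ℕ) : ℤ :=
  ∑ a ∈ range ℓ, if v + (a : ZMod n) ∈ Y then 1 else -1

/-- The largest excess of an interval of length at most `n` starting at `v`. -/
def maxExcess (n : ℕ) (Y : Finset (ZMod n)) (v : ZMod n) : ℤ :=
  (range (n + 1)).sup' nonempty_range_add_one (excess n Y v)

theorem excess_succ (n : ℕ) (Y : Finset (ZMod n)) (v : ZMod n) (ℓ : ℕ) :
    excess n Y v (ℓ + 1) = (if v ∈ Y then 1 else -1) + excess n Y (v + 1) ℓ := by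
  simp only [excess, sum_range_succ', Nat.cast_zero, add_zero, Nat.cast_succ]
  rw [add_comm]
  simp only [add_assoc, add_comm (1 : ZMod n)]

theorem excess_eq (n : ℕ) (Y : Finset (ZMod n)) (v : ZMod n) (ℓ : ℕ) :
    excess n Y v ℓ = 2 * (#{a ∈ range ℓ | v + ((a : ℕ) : ZMod n) ∈ Y} : ℤ) - ℓ := by
  have h (a : ℕ) : (if v + (a : ZMod n) ∈ Y then 1 else -1 : ℤ) =
      2 * (if v + (a : ZMod n) ∈ Y then 1 else 0) - 1 := by split_ifs <;> norm_num
  simp only [excess, h, sum_sub_distrib, ← mul_sum, sum_boole]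
  simp

theorem excess_le_maxExcess {n : ℕ} (Y : Finset (ZMod n)) (v : ZMod n) {ℓ : ℕ} (hℓ : ℓ ≤ n) :
    excess n Y v ℓ ≤ maxExcess n Y v :=
  le_sup' (excess n Y v) (mem_range_succ_iff.2 hℓ)

theorem maxExcess_nonneg (n : ℕ) (Y : Finset (ZMod n)) (v : ZMod n) : 0 ≤ maxExcess n Y v :=
  excess_le_maxExcess Y v n.zero_le

theorem maxExcess_le (n : ℕ) (Y : Finset (ZMod n)) (v : ZMod n) :
    maxExcess n Y v ≤ max 0 ((if v ∈ Y then 1 else -1) + maxExcess n Y (v + 1)) := by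
  refine sup'_le _ _ fun ℓ hℓ => ?_
  rw [mem_range_succ_iff] at hℓ
  cases ℓ with
  | zero => exact le_max_left _ _
  | succ k =>
    rw [excess_succ]
    exact le_max_of_le_right (by gcongr; exact excess_le_maxExcess Y _ (by omega))

theorem maxExcess_pos_of_not_isGoodVertex {n : ℕ} {Y : Finset (ZMod n)} {v : ZMod n}
    (hv : v ∉ Y) (hbad : ¬ IsGoodVertex n Y v) : 0 < maxExcess n Y v := by
  simp only [IsGoodVertex, hv, not_false_eq_true, true_and, not_forall, not_le] at hbad
  obtain ⟨ℓ, -, hℓ, hlt⟩ := hbad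
  refine lt_of_lt_of_le ?_ (excess_le_maxExcess Y v hℓ)
  rw [excess_eq]
  have hcard : #(((range ℓ).image fun a : ℕ => v + (a : ZMod n)) ∩ Y) ≤
      #{a ∈ range ℓ | v + ((a : ℕ) : ZMod n) ∈ Y} := by
    rw [← filter_mem_eq_inter, filter_image]
    exact card_image_le
  omega

theorem card_maxExcess_pos_le (n : ℕ) [NeZero n] (Y : Finset (ZMod n)) :
    #{v | v ∉ Y ∧ 0 < maxExcess n Y v} ≤ #Y := by
  have hshift : ∑ v, maxExcess n Y (v + 1) = ∑ v, maxExcess n Y v :=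
    Equiv.sum_comp (Equiv.addRight (1 : ZMod n)) (maxExcess n Y)
  have hstep : ∀ v ∈ (univ : Finset (ZMod n)),
      maxExcess n Y v + (if v ∉ Y ∧ 0 < maxExcess n Y v then 1 else 0) ≤
        maxExcess n Y (v + 1) + if v ∈ Y then 1 else 0 := by
    intro v _
    have h := maxExcess_le n Y v
    have h' := maxExcess_nonneg n Y (v + 1)
    by_cases hv : v ∈ Y <;> simp only [hv, if_true, if_false, not_true, not_false_eq_true,
      true_and, false_and] at h ⊢
    · omega
    · split_ifs <;> omega
  have hsum := sum_le_sum hstep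
  rw [sum_add_distrib, sum_add_distrib, hshift, add_le_add_iff_left] at hsum
  simpa using hsum

/-- Let `n ≥ 1` and `Y ⊆ ℤ/nℤ` with `|Y| ≤ n/2`. Then the set `B` of
vertices which are neither in `Y` nor good satisfies `|B| ≤ |Y|`. -/
theorem bad_vertices_le_visited
    (n : ℕ) [NeZero n] (Y : Finset (ZMod n)) (hY : 2 * Y.card ≤ n) :
    {v : ZMod n | v ∉ Y ∧ ¬ IsGoodVertex n Y v}.ncard ≤ Y.card := by
  refine le_trans ?_ (card_maxExcess_pos_le n Y)
  rw [← Set.ncard_coe_finset]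
  refine Set.ncard_le_ncard (fun v hv => ?_) (finite_toSet _)
  simpa using ⟨hv.1, maxExcess_pos_of_not_isGoodVertex hv.1 hv.2⟩
end
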